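/- (Additive splitting of the braid Lie algebra.) For every n ≥ 2, let f : FreeLieAlgebra ℚ (Fin (n-1)) → B_n be the Lie algebra homomorphism sending the i-th generator to x_{in}, and let ι : B_{n-1} → B_n be the Lie algebra homomorphism determined by x_{ij} ↦ x_{ij} (for 1 ≤ i, j ≤ n-1). Then the ℚ-linear map FreeLieAlgebra ℚ (Fin (n-1)) × B_{n-1} → B_n given by (u, v) ↦ f(u) + ι(v) is a linear isomorphism of ℚ-vector spaces. -/

import Mathlib

noncomputable section

open FreeLieAlgebra

/-- The defining relations of the braid Lie algebra `B_n`, as elements of the free Lie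
algebra over `ℚ` on the symbols `x_{ij}`, `1 ≤ i, j ≤ n` (here 0-indexed by `Fin n × Fin n`):
(1) `x_{ij} = x_{ji}`; (2) `x_{ii} = 0`; (3) `[x_{ij}, x_{lm}] = 0` when `{i,j} ∩ {l,m} = ∅`;
(4) `[x_{ij}, x_{jl}] = [x_{jl}, x_{li}] = [x_{li}, x_{ij}]` for distinct `i, j, l`. -/
def braidRel (n : ℕ) : Set (FreeLieAlgebra ℚ (Fin n × Fin n)) :=
  {a | (∃ i j : Fin n, a = of ℚ (i, j) - of ℚ (j, i)) ∨
       (∃ i : Fin n, a = of ℚ (i, i)) ∨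
       (∃ i j l m : Fin n, ({i, j} ∩ {l, m} : Set (Fin n)) = ∅ ∧
          a = ⁅of ℚ (i, j), of ℚ (l, m)⁆) ∨
       (∃ i j l : Fin n, i ≠ j ∧ j ≠ l ∧ i ≠ l ∧
          (a = ⁅of ℚ (i, j), of ℚ (j, l)⁆ - ⁅of ℚ (j, l), of ℚ (l, i)⁆ ∨
           a = ⁅of ℚ (j, l), of ℚ (l, i)⁆ - ⁅of ℚ (l, i), of ℚ (i, j)⁆))}

/-- The Lie ideal generated by the braid relations. -/
def braidIdeal (n : ℕ) : LieIdeal ℚ (FreeLieAlgebra ℚ (Fin n × Fin n)) :=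
  LieSubmodule.lieSpan ℚ _ (braidRel n)

/-- The braid Lie algebra `B_n`: the quotient of the free Lie algebra over `ℚ` on the
symbols `x_{ij}`, `1 ≤ i, j ≤ n`, by the Lie ideal generated by the braid relations. -/
abbrev BraidLie (n : ℕ) : Type :=
  FreeLieAlgebra ℚ (Fin n × Fin n) ⧸ braidIdeal n

/-- The class of the generator `x_{ij}` in `B_n`, for `1 ≤ i, j ≤ n`
(junk value `0` out of range). -/
def xgen (n i j : ℕ) : BraidLie n :=
  if h : 1 ≤ i ∧ i ≤ n ∧ 1 ≤ j ∧ j ≤ n then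
    LieSubmodule.Quotient.mk' (braidIdeal n)
      (of ℚ (⟨i - 1, by omega⟩, ⟨j - 1, by omega⟩))
  else 0

/-- The tangent Lie algebra of `L`: the Lie algebra `L ⊗ R[ε]/(ε²)`, with `(a, b)` standing for
`a + ε b`. -/
def LieTangent (L : Type*) : Type _ := L × L

namespace LieTangent

@[ext]
theorem ext {L : Type*} {x y : LieTangent L} (h₁ : x.1 = y.1) (h₂ : x.2 = y.2) : x = y :=
  Prod.ext h₁ h₂

variable {L : Type*} [LieRing L]

instance : AddCommGroup (LieTangent L) := inferInstanceAs (AddCommGroup (L × L))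

instance {R : Type*} [CommRing R] [LieAlgebra R L] : Module R (LieTangent L) :=
  inferInstanceAs (Module R (L × L))

instance : Bracket (LieTangent L) (LieTangent L) where
  bracket x y := (⁅x.1, y.1⁆, ⁅x.1, y.2⁆ - ⁅y.1, x.2⁆)

@[simp] theorem zero_fst : (0 : LieTangent L).1 = 0 := rfl
@[simp] theorem zero_snd : (0 : LieTangent L).2 = 0 := rfl
@[simp] theorem add_fst (x y : LieTangent L) : (x + y).1 = x.1 + y.1 := rfl
@[simp] theorem add_snd (x y : LieTangent L) : (x + y).2 = x.2 + y.2 := rfl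
@[simp] theorem lie_fst (x y : LieTangent L) : ⁅x, y⁆.1 = ⁅x.1, y.1⁆ := rfl
@[simp] theorem lie_snd (x y : LieTangent L) : ⁅x, y⁆.2 = ⁅x.1, y.2⁆ - ⁅y.1, x.2⁆ := rfl

section

variable {R : Type*} [CommRing R] [LieAlgebra R L]

@[simp] theorem smul_fst (r : R) (x : LieTangent L) : (r • x).1 = r • x.1 := rfl
@[simp] theorem smul_snd (r : R) (x : LieTangent L) : (r • x).2 = r • x.2 := rfl

end

instance : LieRing (LieTangent L) where
  add_lie x y z := by ext <;> simp; abel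
  lie_add x y z := by ext <;> simp; abel
  lie_self x := by ext <;> simp
  leibniz_lie x y z := by
    ext
    · simp
    · simp only [lie_snd, lie_fst, lie_sub, lie_lie, add_snd]
      abel

variable {R : Type*} [CommRing R] [LieAlgebra R L]

instance : LieAlgebra R (LieTangent L) where
  lie_smul r x y := by ext <;> simp [smul_sub]

variable (L R) in
/-- The projection `a + ε b ↦ a`. -/
def fstHom : LieTangent L →ₗ⁅R⁆ L where
  toFun x := x.1
  map_add' _ _ := rfl
  map_smul' _ _ := rfl
  map_lie' := rfl

end LieTangent

namespace FreeLieAlgebra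

variable (R : Type*) [CommRing R] {X : Type*}

theorem lieSpan_range_of : LieSubalgebra.lieSpan R (FreeLieAlgebra R X) (Set.range (of R)) = ⊤ := by
  set S := LieSubalgebra.lieSpan R (FreeLieAlgebra R X) (Set.range (of R))
  let g : FreeLieAlgebra R X →ₗ⁅R⁆ S :=
    lift R fun x => ⟨of R x, LieSubalgebra.subset_lieSpan ⟨x, rfl⟩⟩
  have hg : S.incl.comp g = LieHom.id := by ext x; simp [g]
  refine eq_top_iff.2 fun a _ => ?_
  have := LieHom.congr_fun hg a
  simp only [LieHom.comp_apply, LieHom.id_apply] at this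
  rw [← this]
  exact (g a).2

variable {R} in
/-- Induction principle for free Lie algebras. -/
theorem induction {p : FreeLieAlgebra R X → Prop} (of : ∀ x, p (of R x)) (zero : p 0)
    (add : ∀ a b, p a → p b → p (a + b)) (smul : ∀ (r : R) a, p a → p (r • a))
    (lie : ∀ a b, p a → p b → p ⁅a, b⁆) (a : FreeLieAlgebra R X) : p a := by
  have ha : a ∈ LieSubalgebra.lieSpan R (FreeLieAlgebra R X) (Set.range (FreeLieAlgebra.of R)) := by
    rw [lieSpan_range_of]; trivial
  induction ha using LieSubalgebra.lieSpan_induction with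
  | mem x hx => obtain ⟨y, rfl⟩ := hx; exact of y
  | zero => exact zero
  | add x y _ _ hx hy => exact add x y hx hy
  | smul t x _ hx => exact smul t x hx
  | lie x y _ _ hx hy => exact lie x y hx hy

/-- The Lie algebra homomorphism `a ↦ a + ε D a`, where `D` is the derivation extending `d`. -/
def tangentLift (d : X → FreeLieAlgebra R X) :
    FreeLieAlgebra R X →ₗ⁅R⁆ LieTangent (FreeLieAlgebra R X) :=
  lift R fun x => (of R x, d x)

theorem tangentLift_of (d : X → FreeLieAlgebra R X) (x : X) :
    tangentLift R d (of R x) = (of R x, d x) := lift_of_apply _ _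

theorem tangentLift_fst (d : X → FreeLieAlgebra R X) (a : FreeLieAlgebra R X) :
    (tangentLift R d a).1 = a := by
  have h : (LieTangent.fstHom _ R).comp (tangentLift R d) =
      LieHom.id := by
    ext x
    simp only [LieHom.comp_apply, tangentLift_of]
    rfl
  exact LieHom.congr_fun h a

/-- The derivation of a free Lie algebra with prescribed values on the generators. -/
def derivation (d : X → FreeLieAlgebra R X) :
    LieDerivation R (FreeLieAlgebra R X) (FreeLieAlgebra R X) where
  toFun a := (tangentLift R d a).2
  map_add' a b := by simp
  map_smul' r a := by simp
  leibniz' a b := by simp [tangentLift_fst]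

@[simp]
theorem derivation_of (d : X → FreeLieAlgebra R X) (x : X) : derivation R d (of R x) = d x := by
  change (tangentLift R d (of R x)).2 = d x
  rw [tangentLift_of]

variable {R} in
theorem derivation_ext {D₁ D₂ : LieDerivation R (FreeLieAlgebra R X) (FreeLieAlgebra R X)}
    (h : ∀ x, D₁ (of R x) = D₂ (of R x)) : D₁ = D₂ :=
  LieDerivation.ext_of_lieSpan_eq_top _ (lieSpan_range_of R) (by rintro _ ⟨x, rfl⟩; exact h x)

end FreeLieAlgebra

namespace BraidLie

/-- The class of the generator `x_{ij}`, with `i` and `j` in `Fin n`. -/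
def gen {n : ℕ} (i j : Fin n) : BraidLie n :=
  LieSubmodule.Quotient.mk' (braidIdeal n) (of ℚ (i, j))

theorem xgen_eq_gen {n : ℕ} (i j : Fin n) : xgen n (i + 1) (j + 1) = gen i j := by
  rw [xgen, dif_pos ⟨by omega, by omega, by omega, by omega⟩]
  rfl

/-- The quotient map as a homomorphism of Lie algebras. -/
def mkHom (n : ℕ) : FreeLieAlgebra ℚ (Fin n × Fin n) →ₗ⁅ℚ⁆ BraidLie n where
  toLinearMap := (LieSubmodule.Quotient.mk' (braidIdeal n)).toLinearMap
  map_lie' {_ _} := LieSubmodule.Quotient.mk_bracket (I := braidIdeal n) _ _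

theorem mkHom_surjective (n : ℕ) : Function.Surjective (mkHom n) :=
  LieSubmodule.Quotient.surjective_mk' _

theorem mkHom_of {n : ℕ} (i j : Fin n) : mkHom n (of ℚ (i, j)) = gen i j := rfl

theorem mkHom_eq_zero {n : ℕ} {a : FreeLieAlgebra ℚ (Fin n × Fin n)} (h : a ∈ braidRel n) :
    mkHom n a = 0 :=
  (LieSubmodule.Quotient.mk_eq_zero _).2 (LieSubmodule.subset_lieSpan h)

theorem gen_symm {n : ℕ} (i j : Fin n) : gen i j = gen j i := by
  have := mkHom_eq_zero (n := n) (Or.inl ⟨i, j, rfl⟩)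
  rwa [map_sub, sub_eq_zero, mkHom_of, mkHom_of] at this

theorem gen_self {n : ℕ} (i : Fin n) : gen i i = 0 :=
  mkHom_eq_zero (n := n) (Or.inr (Or.inl ⟨i, rfl⟩))

theorem inter_pair_eq_empty {α : Type*} {i j l m : α} :
    ({i, j} ∩ {l, m} : Set α) = ∅ ↔ i ≠ l ∧ i ≠ m ∧ j ≠ l ∧ j ≠ m := by
  rw [← Set.disjoint_iff_inter_eq_empty]
  simp only [Set.disjoint_insert_left, Set.disjoint_singleton_left, Set.mem_insert_iff,
    Set.mem_singleton_iff, not_or]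
  tauto

theorem gen_comm {n : ℕ} {i j l m : Fin n} (hil : i ≠ l) (him : i ≠ m) (hjl : j ≠ l)
    (hjm : j ≠ m) : ⁅gen i j, gen l m⁆ = 0 := by
  have := mkHom_eq_zero (n := n) (Or.inr (Or.inr (Or.inl
    ⟨i, j, l, m, inter_pair_eq_empty.2 ⟨hil, him, hjl, hjm⟩, rfl⟩)))
  rwa [LieHom.map_lie, mkHom_of, mkHom_of] at this

theorem gen_cyclic {n : ℕ} {i j l : Fin n} (hij : i ≠ j) (hjl : j ≠ l) (hil : i ≠ l) :
    ⁅gen i j, gen j l⁆ = ⁅gen j l, gen l i⁆ := by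
  have := mkHom_eq_zero (n := n) (Or.inr (Or.inr (Or.inr ⟨i, j, l, hij, hjl, hil, Or.inl rfl⟩)))
  rwa [map_sub, sub_eq_zero, LieHom.map_lie, LieHom.map_lie, mkHom_of, mkHom_of, mkHom_of] at this

section Lift

variable {L : Type*} [LieRing L] [LieAlgebra ℚ L]

/-- A family of elements of a Lie algebra satisfying the braid relations. -/
structure IsBraidFamily {n : ℕ} (φ : Fin n → Fin n → L) : Prop where
  symm : ∀ i j, φ i j = φ j i
  self : ∀ i, φ i i = 0
  comm : ∀ i j l m, i ≠ l → i ≠ m → j ≠ l → j ≠ m → ⁅φ i j, φ l m⁆ = 0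
  cyclic : ∀ i j l, i ≠ j → j ≠ l → i ≠ l → ⁅φ i j, φ j l⁆ = ⁅φ j l, φ l i⁆

variable {n : ℕ} {φ : Fin n → Fin n → L}

theorem IsBraidFamily.braidIdeal_le (h : IsBraidFamily φ) :
    braidIdeal n ≤ (FreeLieAlgebra.lift ℚ fun p : Fin n × Fin n => φ p.1 p.2).ker := by
  refine LieSubmodule.lieSpan_le.2 ?_
  rintro a (⟨i, j, rfl⟩ | ⟨i, rfl⟩ | ⟨i, j, l, m, hd, rfl⟩ | ⟨i, j, l, hij, hjl, hil, rfl | rfl⟩)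
  · simp [h.symm i j]
  · simp [h.self i]
  · obtain ⟨h₁, h₂, h₃, h₄⟩ := inter_pair_eq_empty.1 hd
    simp [h.comm i j l m h₁ h₂ h₃ h₄]
  · simp [h.cyclic i j l hij hjl hil]
  · simp [h.cyclic j l i hjl hil.symm hij.symm]

/-- The homomorphism out of `B_n` determined by a family satisfying the braid relations. -/
def lift (h : IsBraidFamily φ) : BraidLie n →ₗ⁅ℚ⁆ L where
  toLinearMap := (braidIdeal n).toSubmodule.liftQ
    (FreeLieAlgebra.lift ℚ fun p : Fin n × Fin n => φ p.1 p.2).toLinearMap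
    fun _ ha => h.braidIdeal_le ha
  map_lie' {x y} := by
    obtain ⟨a, rfl⟩ := mkHom_surjective n x
    obtain ⟨b, rfl⟩ := mkHom_surjective n y
    rw [← LieHom.map_lie]
    exact LieHom.map_lie (FreeLieAlgebra.lift ℚ fun p : Fin n × Fin n => φ p.1 p.2) a b

@[simp]
theorem lift_gen (h : IsBraidFamily φ) (i j : Fin n) : lift h (gen i j) = φ i j :=
  lift_of_apply (R := ℚ) (fun p : Fin n × Fin n => φ p.1 p.2) (i, j)

theorem hom_ext {F₁ F₂ : BraidLie n →ₗ⁅ℚ⁆ L} (h : ∀ i j, F₁ (gen i j) = F₂ (gen i j)) :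
    F₁ = F₂ := by
  have : F₁.comp (mkHom n) = F₂.comp (mkHom n) :=
    FreeLieAlgebra.hom_ext fun ⟨i, j⟩ => h i j
  refine LieHom.ext fun x => ?_
  obtain ⟨a, rfl⟩ := mkHom_surjective n x
  exact LieHom.congr_fun this a

end Lift

/-- The derivation of the free Lie algebra on `t_1, …, t_m` sending `t_i` to `[t_i, t_j]`, `t_j` to
`[t_j, t_i]` and all the other generators to `0`. -/
def genDerivation {m : ℕ} (i j : Fin m) :
    LieDerivation ℚ (FreeLieAlgebra ℚ (Fin m)) (FreeLieAlgebra ℚ (Fin m)) :=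
  derivation ℚ fun k =>
    (if k = i then ⁅of ℚ i, of ℚ j⁆ else 0) + (if k = j then ⁅of ℚ j, of ℚ i⁆ else 0)

theorem genDerivation_of {m : ℕ} (i j k : Fin m) : genDerivation i j (of ℚ k) =
    (if k = i then ⁅of ℚ i, of ℚ j⁆ else 0) + (if k = j then ⁅of ℚ j, of ℚ i⁆ else 0) :=
  derivation_of _ _ _

theorem genDerivation_of_left {m : ℕ} {i j : Fin m} (h : i ≠ j) :
    genDerivation i j (of ℚ i) = ⁅of ℚ i, of ℚ j⁆ := by
  simp [genDerivation_of, h]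

theorem genDerivation_of_right {m : ℕ} {i j : Fin m} (h : i ≠ j) :
    genDerivation i j (of ℚ j) = ⁅of ℚ j, of ℚ i⁆ := by
  simp [genDerivation_of, h.symm]

theorem genDerivation_of_ne {m : ℕ} {i j k : Fin m} (hi : k ≠ i) (hj : k ≠ j) :
    genDerivation i j (of ℚ k) = 0 := by
  simp [genDerivation_of, hi, hj]

theorem isBraidFamily_genDerivation (m : ℕ) :
    IsBraidFamily (genDerivation : Fin m → Fin m → _) where
  symm i j := derivation_ext fun k => by rw [genDerivation_of, genDerivation_of, add_comm]
  self i := derivation_ext fun k => by simp [genDerivation_of]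
  comm i j l p hil hip hjl hjp := derivation_ext fun k => by
    have h₁ : ∀ a b, (a = i ∨ a = j) → (b = i ∨ b = j) →
        genDerivation l p ⁅of ℚ a, of ℚ b⁆ = 0 := by
      rintro a b (rfl | rfl) (rfl | rfl) <;> simp [genDerivation_of_ne, *]
    have h₂ : ∀ a b, (a = l ∨ a = p) → (b = l ∨ b = p) →
        genDerivation i j ⁅of ℚ a, of ℚ b⁆ = 0 := by
      rintro a b (rfl | rfl) (rfl | rfl) <;> simp [genDerivation_of_ne, *, Ne.symm]
    rw [LieDerivation.lie_apply, genDerivation_of l p k, genDerivation_of i j k]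
    split_ifs <;> simp only [map_add, map_zero, h₁, h₂, true_or, or_true, add_zero, sub_zero,
      LieDerivation.zero_apply]
  cyclic i j l hij hjl hil := derivation_ext fun k => by
    rw [LieDerivation.lie_apply, LieDerivation.lie_apply]
    by_cases hi : k = i
    · subst hi
      simp [genDerivation_of_left, genDerivation_of_right, genDerivation_of_ne, *, Ne.symm]
      rw [← lie_lie, ← lie_skew, ← lie_skew (of ℚ l), lie_neg]
    by_cases hj : k = j
    · subst hj
      simp [genDerivation_of_left, genDerivation_of_right, genDerivation_of_ne, *, Ne.symm]
      rw [← lie_skew (of ℚ l) (of ℚ i), ← lie_skew (of ℚ i) (of ℚ k), ← lie_skew (of ℚ l) (of ℚ k)]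
      simp only [lie_neg]
      rw [leibniz_lie (of ℚ k) (of ℚ i), ← lie_skew ⁅of ℚ k, of ℚ i⁆ (of ℚ l)]
      abel
    by_cases hl : k = l
    · subst hl
      simp [genDerivation_of_left, genDerivation_of_right, genDerivation_of_ne, *, Ne.symm]
      rw [← lie_skew (of ℚ j) (of ℚ i), lie_neg, leibniz_lie (of ℚ k) (of ℚ i),
        ← lie_skew ⁅of ℚ k, of ℚ i⁆ (of ℚ j)]
      abel
    simp [genDerivation_of_ne, *]

/-- The action of `B_m` on the free Lie algebra on `m` generators. -/
def action (m : ℕ) : BraidLie m →ₗ⁅ℚ⁆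
    LieDerivation ℚ (FreeLieAlgebra ℚ (Fin m)) (FreeLieAlgebra ℚ (Fin m)) :=
  lift (isBraidFamily_genDerivation m)

@[simp]
theorem action_gen {m : ℕ} (i j : Fin m) : action m (gen i j) = genDerivation i j :=
  lift_gen _ i j

section Splitting

variable (m : ℕ)

open LieAlgebra (SemiDirectSum)

/-- The semidirect sum of `B_m` and the free Lie algebra on `m` generators. -/
abbrev Semidirect : Type := SemiDirectSum (FreeLieAlgebra ℚ (Fin m)) (BraidLie m) (action m)

/-- The images of the generators of `B_{m+1}` in the semidirect sum. -/
def splitFamily (i j : Fin (m + 1)) : Semidirect m :=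
  Fin.lastCases (motive := fun _ => Semidirect m)
    (Fin.lastCases (motive := fun _ => Semidirect m) 0 (fun b => ⟨of ℚ b, 0⟩) j)
    (fun a => Fin.lastCases (motive := fun _ => Semidirect m) ⟨of ℚ a, 0⟩
      (fun b => ⟨0, gen a b⟩) j) i

@[simp]
theorem splitFamily_last_last : splitFamily m (Fin.last m) (Fin.last m) = 0 := by
  simp [splitFamily]

variable {m}

@[simp]
theorem splitFamily_last_castSucc (b : Fin m) :
    splitFamily m (Fin.last m) b.castSucc = ⟨of ℚ b, 0⟩ := by
  simp [splitFamily]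

@[simp]
theorem splitFamily_castSucc_last (a : Fin m) :
    splitFamily m a.castSucc (Fin.last m) = ⟨of ℚ a, 0⟩ := by
  simp [splitFamily]

@[simp]
theorem splitFamily_castSucc_castSucc (a b : Fin m) :
    splitFamily m a.castSucc b.castSucc = ⟨0, gen a b⟩ := by
  simp [splitFamily]

theorem isBraidFamily_splitFamily : IsBraidFamily (splitFamily m) where
  symm i j := by
    cases i using Fin.lastCases <;> cases j using Fin.lastCases <;> simp
    exact gen_symm _ _
  self i := by
    cases i using Fin.lastCases <;> simp
    exact gen_self _
  comm i j l p hil hip hjl hjp := by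
    cases i using Fin.lastCases <;> cases j using Fin.lastCases <;>
      cases l using Fin.lastCases <;> cases p using Fin.lastCases <;>
      simp_all [gen_comm]
    · exact genDerivation_of_ne hjl hjp
    · exact genDerivation_of_ne hil hip
    · exact genDerivation_of_ne (Ne.symm hip) (Ne.symm hjp)
    · exact genDerivation_of_ne (Ne.symm hil) (Ne.symm hjl)
  cyclic i j l hij hjl hil := by
    cases i using Fin.lastCases <;> cases j using Fin.lastCases <;>
      cases l using Fin.lastCases <;>
      simp_all [genDerivation_of_left, genDerivation_of_right]
    · rw [genDerivation_of_left (Ne.symm hil), lie_skew]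
    · exact gen_cyclic hij hjl hil

/-- The homomorphism from `B_{m+1}` to the semidirect sum. -/
def toSemidirect : BraidLie (m + 1) →ₗ⁅ℚ⁆ Semidirect m := lift isBraidFamily_splitFamily

/-- The homomorphism from the free Lie algebra to `B_{m+1}` sending the `i`-th generator to
`x_{i,m+1}`. -/
def freeHom : FreeLieAlgebra ℚ (Fin m) →ₗ⁅ℚ⁆ BraidLie (m + 1) :=
  FreeLieAlgebra.lift ℚ fun i : Fin m => gen i.castSucc (Fin.last m)

@[simp]
theorem freeHom_of (i : Fin m) : freeHom (of ℚ i) = gen i.castSucc (Fin.last m) :=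
  lift_of_apply _ _

variable {ι : BraidLie m →ₗ⁅ℚ⁆ BraidLie (m + 1)}

theorem lie_gen_freeHom (i j : Fin m) (u : FreeLieAlgebra ℚ (Fin m)) :
    ⁅gen i.castSucc j.castSucc, freeHom u⁆ = freeHom (genDerivation i j u) := by
  induction u using FreeLieAlgebra.induction with
  | zero => simp
  | add a b ha hb => simp [ha, hb]
  | smul r a ha => simp [ha]
  | lie a b ha hb =>
    rw [LieHom.map_lie, leibniz_lie, ha, hb, LieDerivation.apply_lie_eq_add, map_add,
      LieHom.map_lie, LieHom.map_lie]
    exact add_comm _ _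
  | of k =>
    by_cases hij : i = j
    · subst hij
      simp [gen_self, (isBraidFamily_genDerivation m).self]
    by_cases hi : k = i
    · subst hi
      rw [genDerivation_of_left hij, LieHom.map_lie, freeHom_of, freeHom_of,
        gen_symm k.castSucc j.castSucc,
        gen_cyclic (by simpa using Ne.symm hij) (by simp) (by simp), gen_symm (Fin.last m)]
    by_cases hj : k = j
    · subst hj
      rw [genDerivation_of_right hij, LieHom.map_lie, freeHom_of, freeHom_of,
        gen_cyclic (by simpa using hij) (by simp) (by simp), gen_symm (Fin.last m)]
    rw [genDerivation_of_ne hi hj, map_zero, freeHom_of]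
    exact gen_comm (by simpa using Ne.symm hi) (by simp) (by simpa using Ne.symm hj) (by simp)

theorem lie_freeHom (hι : ∀ i j, ι (gen i j) = gen i.castSucc j.castSucc) (b : BraidLie m)
    (u : FreeLieAlgebra ℚ (Fin m)) : ⁅ι b, freeHom u⁆ = freeHom (action m b u) := by
  obtain ⟨a, rfl⟩ := mkHom_surjective m b
  induction a using FreeLieAlgebra.induction generalizing u with
  | zero => simp
  | add a b ha hb => simp [ha, hb]
  | smul r a ha => simp [ha]
  | lie a b ha hb =>
    rw [LieHom.map_lie, LieHom.map_lie, LieHom.map_lie, lie_lie, hb, ha, ha, hb,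
      LieDerivation.lie_apply, map_sub]
  | of p => rw [mkHom_of, hι, lie_gen_freeHom, action_gen]

/-- The homomorphism `(u, v) ↦ f(u) + ι(v)` from the semidirect sum to `B_{m+1}`. -/
def ofSemidirect (hι : ∀ i j, ι (gen i j) = gen i.castSucc j.castSucc) :
    Semidirect m →ₗ⁅ℚ⁆ BraidLie (m + 1) where
  toFun x := freeHom x.left + ι x.right
  map_add' x y := by simp only [SemiDirectSum.add_eq_mk, map_add]; abel
  map_smul' r x := by simp
  map_lie' {x y} := by
    simp only [SemiDirectSum.lie_eq_mk, map_add, map_sub, LieHom.map_lie, ← lie_freeHom hι,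
      add_lie, lie_add]
    rw [← lie_skew (freeHom x.left) (ι y.right)]
    abel

theorem ofSemidirect_apply (hι : ∀ i j, ι (gen i j) = gen i.castSucc j.castSucc)
    (x : Semidirect m) : ofSemidirect hι x = freeHom x.left + ι x.right := rfl

theorem ofSemidirect_toSemidirect (hι : ∀ i j, ι (gen i j) = gen i.castSucc j.castSucc)
    (x : BraidLie (m + 1)) : ofSemidirect hι (toSemidirect x) = x := by
  have h : (ofSemidirect hι).comp toSemidirect = LieHom.id := by
    refine hom_ext fun i j => ?_
    rw [LieHom.comp_apply, toSemidirect, lift_gen, ofSemidirect_apply, LieHom.id_apply]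
    cases i using Fin.lastCases <;> cases j using Fin.lastCases <;> simp [hι, gen_self]
    exact gen_symm _ _
  exact LieHom.congr_fun h x

theorem toSemidirect_freeHom (u : FreeLieAlgebra ℚ (Fin m)) :
    toSemidirect (freeHom u) = SemiDirectSum.inl (action m) u := by
  have h : (toSemidirect (m := m)).comp freeHom = SemiDirectSum.inl (action m) := by
    refine FreeLieAlgebra.hom_ext fun i => ?_
    rw [LieHom.comp_apply, freeHom_of, toSemidirect, lift_gen]
    simp
  exact LieHom.congr_fun h u

theorem toSemidirect_hom (hι : ∀ i j, ι (gen i j) = gen i.castSucc j.castSucc) (v : BraidLie m) :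
    toSemidirect (ι v) = SemiDirectSum.inr (action m) v := by
  have h : toSemidirect.comp ι = SemiDirectSum.inr (action m) := by
    refine hom_ext fun i j => ?_
    rw [LieHom.comp_apply, hι, toSemidirect, lift_gen]
    simp
  exact LieHom.congr_fun h v

/-- The splitting of `B_{m+1}` as the sum of the free Lie algebra and `B_m`. -/
def splitting (hι : ∀ i j, ι (gen i j) = gen i.castSucc j.castSucc) :
    (FreeLieAlgebra ℚ (Fin m) × BraidLie m) ≃ₗ[ℚ] BraidLie (m + 1) :=
  (SemiDirectSum.toProdl (action m)).symm.trans
    { (ofSemidirect hι).toLinearMap with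
      invFun := toSemidirect
      left_inv := fun x => by
        change toSemidirect (freeHom x.left + ι x.right) = x
        rw [map_add, toSemidirect_freeHom, toSemidirect_hom hι]
        ext <;> simp
      right_inv := ofSemidirect_toSemidirect hι }

end Splitting

end BraidLie

/-- Additive splitting of the braid Lie algebra: for `n ≥ 2`, if
`f : FreeLieAlgebra ℚ (Fin (n-1)) → B_n` sends the `i`-th generator to `x_{in}` and
`ι : B_{n-1} → B_n` is the Lie algebra homomorphism determined by `x_{ij} ↦ x_{ij}`,
then `(u, v) ↦ f(u) + ι(v)` is a `ℚ`-linear isomorphism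
`FreeLieAlgebra ℚ (Fin (n-1)) × B_{n-1} ≃ B_n`. -/
theorem braid_additive_splitting (n : ℕ) (hn : 2 ≤ n)
    (ι : BraidLie (n - 1) →ₗ⁅ℚ⁆ BraidLie n)
    (hι : ∀ i j : ℕ, 1 ≤ i → i ≤ n - 1 → 1 ≤ j → j ≤ n - 1 →
      ι (xgen (n - 1) i j) = xgen n i j) :
    ∃ e : (FreeLieAlgebra ℚ (Fin (n - 1)) × BraidLie (n - 1)) ≃ₗ[ℚ] BraidLie n,
      ∀ (u : FreeLieAlgebra ℚ (Fin (n - 1))) (v : BraidLie (n - 1)),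
        e (u, v) =
          FreeLieAlgebra.lift ℚ (fun i : Fin (n - 1) => xgen n (i.val + 1) n) u
            + ι v := by
  obtain ⟨m, rfl⟩ : ∃ m, n = m + 1 := ⟨n - 1, by omega⟩
  have h : ∀ i j : Fin m,
      ι (BraidLie.gen i j) = BraidLie.gen i.castSucc j.castSucc := fun i j => by
    have := hι (i + 1) (j + 1) (by omega) (by omega) (by omega) (by omega)
    rwa [show xgen (m + 1 - 1) (i + 1) (j + 1) = BraidLie.gen i j from BraidLie.xgen_eq_gen i j,
      show xgen (m + 1) (i + 1) (j + 1) = BraidLie.gen i.castSucc j.castSucc from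
        BraidLie.xgen_eq_gen i.castSucc j.castSucc] at this
  refine ⟨BraidLie.splitting h, fun u v => ?_⟩
  have hx : (fun i : Fin m => xgen (m + 1) (i + 1) (m + 1)) =
      fun i => BraidLie.gen i.castSucc (Fin.last m) :=
    funext fun i => BraidLie.xgen_eq_gen i.castSucc (Fin.last m)
  change BraidLie.freeHom (m := m) u + (ι v : BraidLie (m + 1)) =
    FreeLieAlgebra.lift ℚ (fun i : Fin m => xgen (m + 1) (i + 1) (m + 1)) u + ι v
  rw [hx, BraidLie.freeHom]

end
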